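/- For every ν ∈ [-1/2, 1) and all positive reals θ₁, θ₂, θ₃, setting m = (θ₁+θ₂+θ₃)/3 and C̃_ν = ν²(5−2ν)/3, one has ∏_{i=1}^{3} ((1−ν)m + νθᵢ) ≥ (θ₁θ₂θ₃)^{C̃_ν} · m^{3(1−C̃_ν)}. -/

import Mathlib

/-- Up to the factor `ν² (1 - ν) / 3`, the numerator of the derivative at `1` of
`log P(ν u) - C log P(u)` for `P(u) = 1 - a u² + b u³` and `C = ν² (5 - 2 ν) / 3`. -/
def derivNumerator (ν a b : ℝ) : ℝ :=
  4 * a - 15 * b + (6 + 6 * ν - 4 * ν ^ 2) * a ^ 2 - (6 + 15 * ν - 4 * ν ^ 3) * (a * b)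
    + 3 * ν * (3 + 3 * ν - 2 * ν ^ 2) * b ^ 2

lemma derivNumerator_double_root_nonneg {ν s : ℝ} (hν1 : -1/2 ≤ ν) (hν2 : ν < 1)
    (hs0 : 0 ≤ s) (hs1 : s ≤ 1) : 0 ≤ derivNumerator ν (3 * s ^ 2) (2 * s ^ 3) := by
  have hA : 2 ≤ 6 + 6 * ν - 4 * ν ^ 2 := by nlinarith
  have hQ : 0 ≤ 2 - (3 - 2 * ν) * s + (6 + 6 * ν - 4 * ν ^ 2) * s ^ 2 := by
    have hdisc : (3 - 2 * ν) ^ 2 ≤ 8 * (6 + 6 * ν - 4 * ν ^ 2) := by nlinarith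
    nlinarith [sq_nonneg (4 - (3 - 2 * ν) * s), mul_le_mul_of_nonneg_right hdisc (sq_nonneg s)]
  have hνs : 0 ≤ 1 - ν * s := by nlinarith
  have h := mul_nonneg (mul_nonneg (mul_nonneg (sq_nonneg s) (sub_nonneg.2 hs1)) hνs) hQ
  unfold derivNumerator
  linarith

lemma derivNumerator_nonneg_of_two_nonpos {ν p q : ℝ} (hν1 : -1/2 ≤ ν) (hν2 : ν < 1)
    (hp0 : 0 ≤ p) (hp1 : p ≤ 1) (hq0 : 0 ≤ q) (hq1 : q ≤ 1) :
    0 ≤ derivNumerator ν (p ^ 2 + p * q + q ^ 2) (p * q * (p + q)) := by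
  obtain ⟨s, hs⟩ : ∃ s, s = (p + q) / 2 := ⟨_, rfl⟩
  have hs0 : 0 ≤ s := by linarith
  have hs1 : s ≤ 1 := by linarith
  obtain ⟨a, ha⟩ : ∃ a, a = p ^ 2 + p * q + q ^ 2 := ⟨_, rfl⟩
  obtain ⟨b, hb⟩ : ∃ b, b = p * q * (p + q) := ⟨_, rfl⟩
  have ha3 : a ≤ 3 := by nlinarith
  have has : 3 * s ^ 2 ≤ a := by subst hs ha; nlinarith [sq_nonneg (p - q)]
  have hb0 : 0 ≤ b := by subst hb; positivity
  have hbs : b ≤ 2 * s ^ 3 := by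
    subst hs hb; nlinarith [mul_nonneg (add_nonneg hp0 hq0) (sq_nonneg (p - q))]
  rw [← ha, ← hb]
  have hs3 : s ^ 3 ≤ s ^ 2 := by nlinarith [sq_nonneg s]
  have hs2 : s ^ 2 ≤ 1 := by nlinarith
  have hA : 2 ≤ 6 + 6 * ν - 4 * ν ^ 2 := by nlinarith
  have hB : -1 ≤ 6 + 15 * ν - 4 * ν ^ 3 := by
    nlinarith [mul_nonneg (by linarith : 0 ≤ 1 - ν) (sq_nonneg (2 * ν + 1))]
  have hmono_b : derivNumerator ν a (2 * s ^ 3) ≤ derivNumerator ν a b := by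
    have key : 3 * ν * (3 + 3 * ν - 2 * ν ^ 2) * (2 * s ^ 3 + b)
        ≤ 15 + (6 + 15 * ν - 4 * ν ^ 3) * a := by
      have h0 : 0 ≤ 2 * s ^ 3 + b := by positivity
      rcases le_total ν 0 with hν | hν
      · have hD : 3 * ν * (3 + 3 * ν - 2 * ν ^ 2) ≤ 0 :=
          mul_nonpos_of_nonpos_of_nonneg (by linarith) (by nlinarith)
        have ha0 : 0 ≤ a := by linarith [sq_nonneg s]
        linarith [mul_nonpos_of_nonpos_of_nonneg hD h0, mul_le_mul_of_nonneg_right hB ha0]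
      · have hD : 0 ≤ 3 * ν * (3 + 3 * ν - 2 * ν ^ 2) :=
          mul_nonneg (by linarith) (by nlinarith)
        have hB0 : 0 ≤ 6 + 15 * ν - 4 * ν ^ 3 := by
          nlinarith [mul_nonneg hν (by nlinarith : 0 ≤ 1 - ν ^ 2)]
        have hDB : 4 * (3 * ν * (3 + 3 * ν - 2 * ν ^ 2)) ≤ 15 + 3 * (6 + 15 * ν - 4 * ν ^ 3) := by
          nlinarith [mul_nonneg hν (sq_nonneg (1 - ν))]
        have k1 := mul_le_mul_of_nonneg_left (by linarith : 2 * s ^ 3 + b ≤ 4 * s ^ 2) hD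
        have k2 := mul_le_mul_of_nonneg_left has hB0
        have k3 := mul_le_mul_of_nonneg_right hDB (sq_nonneg s)
        linarith
    have h := mul_nonneg (sub_nonneg.2 hbs) (sub_nonneg.2 key)
    unfold derivNumerator
    linarith
  have hmono_a : derivNumerator ν (3 * s ^ 2) (2 * s ^ 3) ≤ derivNumerator ν a (2 * s ^ 3) := by
    have key : (6 + 15 * ν - 4 * ν ^ 3) * (2 * s ^ 3)
        ≤ 4 + (6 + 6 * ν - 4 * ν ^ 2) * (a + 3 * s ^ 2) := by
      have h1 : (6 + 6 * ν - 4 * ν ^ 2) * (6 * s ^ 2) ≤ (6 + 6 * ν - 4 * ν ^ 2) * (a + 3 * s ^ 2) :=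
        mul_le_mul_of_nonneg_left (by linarith) (by linarith)
      have h2 : (7 + 15 * ν - 4 * ν ^ 3) * s ^ 3 ≤ (7 + 15 * ν - 4 * ν ^ 3) * s ^ 2 :=
        mul_le_mul_of_nonneg_left hs3 (by linarith)
      have h3 : 2 * (7 + 15 * ν - 4 * ν ^ 3) ≤ 4 + 6 * (6 + 6 * ν - 4 * ν ^ 2) := by
        nlinarith [mul_nonneg (by linarith : 0 ≤ 1 - ν) (sq_nonneg (2 * ν + 1))]
      have h4 := mul_le_mul_of_nonneg_right h3 (sq_nonneg s)
      have h5 : 0 ≤ s ^ 3 := by positivity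
      linarith
    have h := mul_nonneg (sub_nonneg.2 has) (sub_nonneg.2 key)
    unfold derivNumerator
    linarith
  exact (derivNumerator_double_root_nonneg hν1 hν2 hs0 hs1).trans (hmono_a.trans hmono_b)

lemma derivNumerator_nonneg_of_two_nonneg {ν p q : ℝ} (hν1 : -1/2 ≤ ν) (hν2 : ν < 1)
    (hp : 0 ≤ p) (hq : 0 ≤ q) (hpq : p + q ≤ 1) :
    0 ≤ derivNumerator ν (p ^ 2 + p * q + q ^ 2) (-(p * q * (p + q))) := by
  obtain ⟨a, ha⟩ : ∃ a, a = p ^ 2 + p * q + q ^ 2 := ⟨_, rfl⟩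
  obtain ⟨c, hc⟩ : ∃ c, c = p * q * (p + q) := ⟨_, rfl⟩
  have ha0 : 0 ≤ a := by subst ha; positivity
  have hc0 : 0 ≤ c := by subst hc; positivity
  have ha1 : a ≤ 1 := by nlinarith [mul_nonneg hp hq]
  have hc1 : c ≤ 1 := by nlinarith [mul_nonneg hp hq]
  have hA : 2 ≤ 6 + 6 * ν - 4 * ν ^ 2 := by nlinarith
  have hB : -1 ≤ 6 + 15 * ν - 4 * ν ^ 3 := by
    nlinarith [mul_nonneg (by linarith : 0 ≤ 1 - ν) (sq_nonneg (2 * ν + 1))]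
  have hD : -6 ≤ 3 * ν * (3 + 3 * ν - 2 * ν ^ 2) := by
    nlinarith [mul_nonneg (by linarith : 0 ≤ 1 - ν) (sq_nonneg (2 * ν + 1)), sq_nonneg (2 * ν + 1)]
  rw [← ha, ← hc]
  have h1 := mul_le_mul_of_nonneg_right hA (sq_nonneg a)
  have h2 := mul_le_mul_of_nonneg_right hB (mul_nonneg ha0 hc0)
  have h3 := mul_le_mul_of_nonneg_right hD (sq_nonneg c)
  have h4 : a * c ≤ c := mul_le_of_le_one_left hc0 ha1
  have h5 : c ^ 2 ≤ c := by nlinarith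
  unfold derivNumerator
  nlinarith [sq_nonneg a]

lemma derivNumerator_nonneg {ν x y z : ℝ} (hν1 : -1/2 ≤ ν) (hν2 : ν < 1)
    (hx : -1 ≤ x) (hy : -1 ≤ y) (hz : -1 ≤ z) (hsum : x + y + z = 0) :
    0 ≤ derivNumerator ν (-(x * y + y * z + z * x)) (x * y * z) := by
  have same_sign : ∀ {x y z : ℝ}, -1 ≤ x → -1 ≤ y → -1 ≤ z → x + y + z = 0 → 0 ≤ x * y →
      0 ≤ derivNumerator ν (-(x * y + y * z + z * x)) (x * y * z) := by
    intro x y z hx hy hz hsum hxy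
    obtain rfl : z = -(x + y) := by linarith
    rcases mul_nonneg_iff.1 hxy with ⟨hx0, hy0⟩ | ⟨hx0, hy0⟩
    · convert derivNumerator_nonneg_of_two_nonneg hν1 hν2 hx0 hy0 (by linarith) using 2 <;> ring
    · convert derivNumerator_nonneg_of_two_nonpos hν1 hν2 (neg_nonneg.2 hx0) (by linarith)
        (neg_nonneg.2 hy0) (by linarith) using 2 <;> ring
  by_cases hxy : 0 ≤ x * y
  · exact same_sign hx hy hz hsum hxy
  by_cases hyz : 0 ≤ y * z
  · convert same_sign hy hz hx (by linarith) hyz using 2 <;> ring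
  have hzx : 0 ≤ z * x := by
    rcases le_total 0 x with h | h <;> rcases le_total 0 y with h' | h' <;>
      rcases le_total 0 z with h'' | h'' <;> nlinarith
  convert same_sign hz hx hy (by linarith) hzx using 2 <;> ring

lemma cubic_pos {ν x y z : ℝ} (hν1 : -1/2 ≤ ν) (hν2 : ν ≤ 1)
    (hx : -1 < x) (hy : -1 < y) (hz : -1 < z) (hsum : x + y + z = 0) :
    0 < 1 + ν ^ 2 * (x * y + y * z + z * x) + ν ^ 3 * (x * y * z) := by
  have factor_pos : ∀ t : ℝ, -1 < t → t < 2 → 0 < 1 + ν * t := by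
    intro t ht1 ht2
    rcases le_total 0 ν with h | h <;> nlinarith
  have h := mul_pos (mul_pos (factor_pos x hx (by linarith)) (factor_pos y hy (by linarith)))
    (factor_pos z hz (by linarith))
  obtain rfl : z = -(x + y) := by linarith
  linarith

lemma mul_log_cubic_le_log_cubic {ν x y z : ℝ} (hν1 : -1/2 ≤ ν) (hν2 : ν < 1)
    (hx : -1 < x) (hy : -1 < y) (hz : -1 < z) (hsum : x + y + z = 0) :
    ν ^ 2 * (5 - 2 * ν) / 3 * Real.log (1 + (x * y + y * z + z * x) + x * y * z)
      ≤ Real.log (1 + ν ^ 2 * (x * y + y * z + z * x) + ν ^ 3 * (x * y * z)) := by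
  obtain ⟨e, he⟩ : ∃ e, e = x * y + y * z + z * x := ⟨_, rfl⟩
  obtain ⟨b, hb⟩ : ∃ b, b = x * y * z := ⟨_, rfl⟩
  have scale : ∀ {t u : ℝ}, -1 < t → u ∈ Set.Icc (0 : ℝ) 1 → -1 < u * t := by
    intro t u ht hu
    rcases le_total 0 t with h | h <;> nlinarith [hu.1, hu.2]
  have pos : ∀ {κ u : ℝ}, -1/2 ≤ κ → κ ≤ 1 → u ∈ Set.Icc (0 : ℝ) 1 →
      0 < 1 + κ ^ 2 * e * u ^ 2 + κ ^ 3 * b * u ^ 3 := by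
    intro κ u h1 h2 hu
    have h := cubic_pos h1 h2 (scale hx hu) (scale hy hu) (scale hz hu)
      (by rw [← mul_add, ← mul_add, hsum, mul_zero])
    subst he hb
    linarith
  have poly_deriv : ∀ κ u : ℝ, HasDerivAt (fun u : ℝ ↦ 1 + κ ^ 2 * e * u ^ 2 + κ ^ 3 * b * u ^ 3)
      (2 * κ ^ 2 * e * u + 3 * κ ^ 3 * b * u ^ 2) u := by
    intro κ u
    have h := (((hasDerivAt_pow 2 u).const_mul (κ ^ 2 * e)).const_add 1).add
      ((hasDerivAt_pow 3 u).const_mul (κ ^ 3 * b))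
    refine h.congr_deriv ?_
    push_cast
    ring
  have log_deriv : ∀ u ∈ Set.Icc (0 : ℝ) 1, HasDerivAt
      (fun u : ℝ ↦ Real.log (1 + ν ^ 2 * e * u ^ 2 + ν ^ 3 * b * u ^ 3)
        - ν ^ 2 * (5 - 2 * ν) / 3 * Real.log (1 + 1 ^ 2 * e * u ^ 2 + 1 ^ 3 * b * u ^ 3)) _ u :=
    fun u hu ↦ ((poly_deriv ν u).log (pos hν1 hν2.le hu).ne').sub
      (((poly_deriv 1 u).log (pos (by norm_num) le_rfl hu).ne').const_mul _)
  have mono := monotoneOn_of_deriv_nonneg (convex_Icc (0 : ℝ) 1)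
    (fun u hu ↦ (log_deriv u hu).continuousAt.continuousWithinAt)
    (fun u hu ↦ (log_deriv u (interior_subset hu)).differentiableAt.differentiableWithinAt)
    (fun u hu ↦ by
      have hu' := interior_subset hu
      rw [interior_Icc] at hu
      rw [(log_deriv u hu').deriv]
      have hN := derivNumerator_nonneg hν1 hν2 (scale hx hu').le (scale hy hu').le (scale hz hu').le
        (by rw [← mul_add, ← mul_add, hsum, mul_zero])
      have hN' : 0 ≤ derivNumerator ν (-(u ^ 2 * e)) (u ^ 3 * b) := by
        convert hN using 2
        · rw [he]; ring
        · rw [hb]; ring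
      have hP := pos hν1 hν2.le hu'
      have hP1 := pos (κ := 1) (by norm_num) le_rfl hu'
      rw [← mul_div_assoc, div_sub_div _ _ hP.ne' hP1.ne']
      refine div_nonneg ?_ (mul_pos hP hP1).le
      have h := mul_nonneg (mul_nonneg (sq_nonneg ν) (sub_nonneg.2 hν2.le)) hN'
      unfold derivNumerator at h
      refine nonneg_of_mul_nonneg_right (a := 3 * u) ?_ (by linarith [hu.1])
      linarith)
  have h := mono (Set.left_mem_Icc.2 zero_le_one) (Set.right_mem_Icc.2 zero_le_one) zero_le_one
  rw [← he, ← hb]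
  simpa using h

theorem stmt_7 (ν θ₁ θ₂ θ₃ : ℝ) (hν1 : -1/2 ≤ ν) (hν2 : ν < 1)
    (h1 : 0 < θ₁) (h2 : 0 < θ₂) (h3 : 0 < θ₃) :
    ((1-ν) * ((θ₁+θ₂+θ₃)/3) + ν*θ₁) * ((1-ν) * ((θ₁+θ₂+θ₃)/3) + ν*θ₂)
        * ((1-ν) * ((θ₁+θ₂+θ₃)/3) + ν*θ₃)
      ≥ (θ₁*θ₂*θ₃) ^ (ν^2 * (5 - 2*ν) / 3)
        * ((θ₁+θ₂+θ₃)/3) ^ (3 * (1 - ν^2 * (5 - 2*ν) / 3)) := by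
  obtain ⟨m, hm⟩ : ∃ m, m = (θ₁ + θ₂ + θ₃) / 3 := ⟨_, rfl⟩
  have hm0 : 0 < m := by rw [hm]; positivity
  rw [← hm]
  obtain ⟨x, rfl⟩ : ∃ x, θ₁ = m * (1 + x) := ⟨θ₁ / m - 1, by field_simp; ring⟩
  obtain ⟨y, rfl⟩ : ∃ y, θ₂ = m * (1 + y) := ⟨θ₂ / m - 1, by field_simp; ring⟩
  obtain ⟨z, rfl⟩ : ∃ z, θ₃ = m * (1 + z) := ⟨θ₃ / m - 1, by field_simp; ring⟩
  have hx : -1 < x := by linarith [pos_of_mul_pos_right h1 hm0.le]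
  have hy : -1 < y := by linarith [pos_of_mul_pos_right h2 hm0.le]
  have hz : -1 < z := by linarith [pos_of_mul_pos_right h3 hm0.le]
  have hsum : x + y + z = 0 := by
    refine (mul_eq_zero.1 (?_ : m * (x + y + z) = 0)).resolve_left hm0.ne'
    linarith
  have hP := cubic_pos hν1 hν2.le hx hy hz hsum
  have hP1 : 0 < 1 + (x * y + y * z + z * x) + x * y * z := by
    simpa using cubic_pos (ν := 1) (by norm_num) le_rfl hx hy hz hsum
  have hlog := mul_log_cubic_le_log_cubic hν1 hν2 hx hy hz hsum
  have hm3 : 0 < m ^ 3 := by positivity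
  have hprod : m * (1 + x) * (m * (1 + y)) * (m * (1 + z))
      = m ^ 3 * (1 + (x * y + y * z + z * x) + x * y * z) := by
    linear_combination m ^ 3 * hsum
  have hprodν : ((1 - ν) * m + ν * (m * (1 + x))) * ((1 - ν) * m + ν * (m * (1 + y)))
        * ((1 - ν) * m + ν * (m * (1 + z)))
      = m ^ 3 * (1 + ν ^ 2 * (x * y + y * z + z * x) + ν ^ 3 * (x * y * z)) := by
    linear_combination ν * m ^ 3 * hsum
  rw [hprod, hprodν, ge_iff_le, ← Real.log_le_log_iff (by positivity) (by positivity),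
    Real.log_mul (by positivity) (by positivity), Real.log_rpow (by positivity),
    Real.log_rpow hm0, Real.log_mul hm3.ne' hP1.ne', Real.log_mul hm3.ne' hP.ne', Real.log_pow]
  push_cast
  linarith
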